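/- Suppose β = β₁^m = β₂^m (equivalently λ_m(A) = 0 and β = 1). Then for m-a.e. θ ∈ Θ: the fibre 𝒜_β(θ) is not a topological disk; more precisely, there exists a unit vector u(θ) ∈ ℝ² such that 𝒜_β(θ) ∩ {r·u(θ) : r > 0} = ∅. Furthermore, lim_{n→∞} (1/n) Σ_{i=0}^{n−1} ‖f^i_{β,θ}(v)‖ = 0 for all v ∈ ℝ². -/

import Mathlib

open Filter MeasureTheory Metric Set
open scoped Topology

noncomputable section

/-- ℝ² with the Euclidean norm. -/
abbrev R2 : Type := EuclideanSpace ℝ (Fin 2)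

/-- Action of a 2×2 real matrix on Euclidean ℝ². -/
def mulVecE (M : Matrix (Fin 2) (Fin 2) ℝ) (v : R2) : R2 :=
  (WithLp.equiv 2 (Fin 2 → ℝ)).symm (M.mulVec ((WithLp.equiv 2 (Fin 2 → ℝ)) v))

/-- Operator norm of a 2×2 real matrix induced by the Euclidean norm on ℝ². -/
def opNorm (M : Matrix (Fin 2) (Fin 2) ℝ) : ℝ :=
  ‖(Matrix.toEuclideanCLM (𝕜 := ℝ) M : R2 →L[ℝ] R2)‖

/-- The cocycle `A_n(θ) = A(γ^{n-1}θ) ⋯ A(θ)`. -/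
def coc {Θ : Type*} (γ : Θ → Θ) (A : Θ → Matrix (Fin 2) (Fin 2) ℝ) :
    ℕ → Θ → Matrix (Fin 2) (Fin 2) ℝ
  | 0, _ => 1
  | n + 1, θ => coc γ A n (γ θ) * A θ

/-- Maximal Lyapunov exponent `λ_max(A) = sup_θ limsup (1/n) log‖A_n(θ)‖`. -/
def lyapMax {Θ : Type*} (γ : Θ → Θ) (A : Θ → Matrix (Fin 2) (Fin 2) ℝ) : ℝ :=
  ⨆ θ : Θ, Filter.limsup (fun n : ℕ => Real.log (opNorm (coc γ A n θ)) / n) Filter.atTop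

/-- The hypotheses on `h`: C² on [0,∞), strictly increasing, strictly concave, bounded,
nonnegative, `h 0 = 0`, `h' 0 = 1`. -/
def GoodH (h : ℝ → ℝ) : Prop :=
  ContDiffOn ℝ 2 h (Set.Ici 0) ∧ StrictMonoOn h (Set.Ici 0) ∧
    StrictConcaveOn ℝ (Set.Ici 0) h ∧ BddAbove (h '' Set.Ici 0) ∧
    (∀ x ∈ Set.Ici (0 : ℝ), 0 ≤ h x) ∧ h 0 = 0 ∧ derivWithin h (Set.Ici 0) 0 = 1

/-- The scaling condition `sup_{x ≥ 0} h(x) ≤ (sup_θ ‖A(θ)‖)⁻¹`. -/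
def Scaled {Θ : Type*} (A : Θ → Matrix (Fin 2) (Fin 2) ℝ) (h : ℝ → ℝ) : Prop :=
  ∀ x ∈ Set.Ici (0 : ℝ), h x ≤ (⨆ θ : Θ, opNorm (A θ))⁻¹

open scoped Classical in
/-- The fibre maps `f_{β,θ}(v) = h(β‖v‖)·A(θ)·v/‖v‖`, `f_{β,θ}(0) = 0`. -/
def fibMap {Θ : Type*} (A : Θ → Matrix (Fin 2) (Fin 2) ℝ) (h : ℝ → ℝ) (β : ℝ)
    (θ : Θ) (v : R2) : R2 :=
  if v = 0 then 0 else (h (β * ‖v‖) / ‖v‖) • mulVecE (A θ) v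

/-- The skew product `f_β(θ,v) = (γθ, f_{β,θ}(v))`. -/
def skewProd {Θ : Type*} (γ : Θ → Θ) (A : Θ → Matrix (Fin 2) (Fin 2) ℝ) (h : ℝ → ℝ)
    (β : ℝ) : Θ × R2 → Θ × R2 :=
  fun p => (γ p.1, fibMap A h β p.1 p.2)

/-- The global attractor `𝒜_β = ⋂_{n∈ℕ} f_β^n(Θ × B̄₁(0))`. -/
def globalAttractor {Θ : Type*} (γ : Θ → Θ) (A : Θ → Matrix (Fin 2) (Fin 2) ℝ)
    (h : ℝ → ℝ) (β : ℝ) : Set (Θ × R2) :=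
  ⋂ n : ℕ, (skewProd γ A h β)^[n] '' (Set.univ ×ˢ Metric.closedBall (0 : R2) 1)

/-- The fibre `𝒜_β(θ) = {x : (θ,x) ∈ 𝒜_β}` of the global attractor. -/
def attractorFib {Θ : Type*} (γ : Θ → Θ) (A : Θ → Matrix (Fin 2) (Fin 2) ℝ)
    (h : ℝ → ℝ) (β : ℝ) (θ : Θ) : Set R2 :=
  {x : R2 | (θ, x) ∈ globalAttractor γ A h β}

/-- `v(α) = (cos 2πα, sin 2πα)ᵗ`. -/
def vFull (α : ℝ) : R2 :=
  (WithLp.equiv 2 (Fin 2 → ℝ)).symm ![Real.cos (2 * Real.pi * α), Real.sin (2 * Real.pi * α)]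

/-- `(cos πα, sin πα)ᵗ`, representing the projective point `α ∈ 𝕋 ≅ ℝP¹`. -/
def vHalf (α : ℝ) : R2 :=
  (WithLp.equiv 2 (Fin 2 → ℝ)).symm ![Real.cos (Real.pi * α), Real.sin (Real.pi * α)]

/-- The projective angle coordinate `p(w) = (1/π)·arg(w) mod 1 ∈ [0,1)` of a nonzero
vector `w ∈ ℝ²`; for `w ≠ 0` this equals `(1/π)·arctan(w₂/w₁) mod 1`. -/
def projAngle (w : R2) : ℝ :=
  Int.fract (Complex.arg (Complex.ofReal (w 0) + Complex.ofReal (w 1) * Complex.I) / Real.pi)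

/-- The projective action `g(θ,α) = (γθ, g_θ(α))` of the cocycle on `Θ × 𝕋`,
where `𝕋` is modelled by the fundamental domain `[0,1) ⊆ ℝ`. -/
def gMap {Θ : Type*} (γ : Θ → Θ) (A : Θ → Matrix (Fin 2) (Fin 2) ℝ) :
    Θ × ℝ → Θ × ℝ :=
  fun p => (γ p.1, projAngle (mulVecE (A p.1) (vHalf p.2)))

/-- `Ω(θ,α) = ‖A(θ)(cos πα, sin πα)ᵗ‖`. -/
def Omega {Θ : Type*} (A : Θ → Matrix (Fin 2) (Fin 2) ℝ) (p : Θ × ℝ) : ℝ :=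
  ‖mulVecE (A p.1) (vHalf p.2)‖

/-- The fibre maps `F_{β,θ,α}(r) = h(βr)·Ω(θ,α)` of the double skew product. -/
def dsFib {Θ : Type*} (A : Θ → Matrix (Fin 2) (Fin 2) ℝ) (h : ℝ → ℝ) (β : ℝ)
    (p : Θ × ℝ) (r : ℝ) : ℝ :=
  h (β * r) * Omega A p

/-- The double skew product `F_β(θ,α,r) = (g(θ,α), h(βr)·Ω(θ,α))` on `Θ × 𝕋 × [0,∞)`. -/
def dsMap {Θ : Type*} (γ : Θ → Θ) (A : Θ → Matrix (Fin 2) (Fin 2) ℝ) (h : ℝ → ℝ)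
    (β : ℝ) : Θ × ℝ × ℝ → Θ × ℝ × ℝ :=
  fun p => ((gMap γ A (p.1, p.2.1)).1, (gMap γ A (p.1, p.2.1)).2, dsFib A h β (p.1, p.2.1) p.2.2)

/-- `Ω_n(θ,α) = ∏_{i=0}^{n-1} Ω(g^i(θ,α))`. -/
def OmegaProd {Θ : Type*} (γ : Θ → Θ) (A : Θ → Matrix (Fin 2) (Fin 2) ℝ) (n : ℕ)
    (p : Θ × ℝ) : ℝ :=
  ∏ i ∈ Finset.range n, Omega A ((gMap γ A)^[i] p)

/-- `Γ(a,b) = inf_{a ≤ x ≤ 1} inf_{0 < q ≤ b} h(qx)/(q·h(x))`. -/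
def GammaH (h : ℝ → ℝ) (a b : ℝ) : ℝ :=
  sInf {y : ℝ | ∃ x ∈ Set.Icc a 1, ∃ q ∈ Set.Ioc (0 : ℝ) b, y = h (q * x) / (q * h x)}

/-- The inverse `g⁻¹(θ,α) = (γ⁻¹θ, projective angle of A(γ⁻¹θ)⁻¹·v(α))` of the
projective action. -/
def gInv {Θ : Type*} (γinv : Θ → Θ) (A : Θ → Matrix (Fin 2) (Fin 2) ℝ) :
    Θ × ℝ → Θ × ℝ :=
  fun p => (γinv p.1, projAngle (mulVecE (A (γinv p.1))⁻¹ (vHalf p.2)))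

/-- `F^n_{β,g^{-n}(θ,α)}(1)`, the pullback iterate defining the upper bounding graph. -/
def pullback1 {Θ : Type*} (γ : Θ → Θ) (γinv : Θ → Θ) (A : Θ → Matrix (Fin 2) (Fin 2) ℝ)
    (h : ℝ → ℝ) (β : ℝ) (n : ℕ) (p : Θ × ℝ) : ℝ :=
  ((dsMap γ A h β)^[n] (((gInv γinv A)^[n] p).1, ((gInv γinv A)^[n] p).2, 1)).2.2

theorem toEuclideanCLM_apply_eq_mulVecE (M : Matrix (Fin 2) (Fin 2) ℝ) (v : R2) :
    Matrix.toEuclideanCLM (𝕜 := ℝ) M v = mulVecE M v := rfl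

theorem norm_mulVecE_le (M : Matrix (Fin 2) (Fin 2) ℝ) (v : R2) :
    ‖mulVecE M v‖ ≤ opNorm M * ‖v‖ :=
  (Matrix.toEuclideanCLM (𝕜 := ℝ) M).le_opNorm v

theorem mulVecE_mul (M N : Matrix (Fin 2) (Fin 2) ℝ) (v : R2) :
    mulVecE (M * N) v = mulVecE M (mulVecE N v) := by
  simp only [← toEuclideanCLM_apply_eq_mulVecE, map_mul]
  rfl

theorem mulVecE_one (v : R2) : mulVecE 1 v = v := by
  simp [← toEuclideanCLM_apply_eq_mulVecE]

theorem mulVecE_smul (M : Matrix (Fin 2) (Fin 2) ℝ) (c : ℝ) (v : R2) :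
    mulVecE M (c • v) = c • mulVecE M v := by
  simp only [← toEuclideanCLM_apply_eq_mulVecE, map_smul]

theorem mulVecE_neg (M : Matrix (Fin 2) (Fin 2) ℝ) (v : R2) :
    mulVecE M (-v) = -mulVecE M v := by
  simp only [← toEuclideanCLM_apply_eq_mulVecE, map_neg]

theorem opNorm_mul_le (M N : Matrix (Fin 2) (Fin 2) ℝ) :
    opNorm (M * N) ≤ opNorm M * opNorm N := by
  unfold opNorm
  rw [map_mul]
  exact norm_mul_le _ _

theorem opNorm_one : opNorm 1 = 1 := by
  unfold opNorm
  rw [map_one]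
  exact norm_one

theorem opNorm_inv_le {M : Matrix (Fin 2) (Fin 2) ℝ} (hM : M.det = 1) :
    opNorm M⁻¹ ≤ opNorm M := by
  set J : Matrix (Fin 2) (Fin 2) ℝ := !![0, -1; 1, 0] with hJ
  have hJu : J ∈ unitary (Matrix (Fin 2) (Fin 2) ℝ) := by
    rw [Unitary.mem_iff]
    constructor <;>
    · ext i j
      fin_cases i <;> fin_cases j <;>
        simp [hJ, Matrix.star_eq_conjTranspose, Matrix.mul_apply, Fin.sum_univ_two]
  have hu : ∀ U ∈ unitary (Matrix (Fin 2) (Fin 2) ℝ), opNorm U = 1 := fun U hU =>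
    CStarRing.norm_of_mem_unitary (Unitary.map_mem (Matrix.toEuclideanCLM (n := Fin 2) (𝕜 := ℝ)) hU)
  have hinv : M⁻¹ = star J * star M * J := by
    rw [Matrix.inv_def, hM, Matrix.adjugate_fin_two]
    ext i j
    fin_cases i <;> fin_cases j <;>
      simp [hJ, Matrix.star_eq_conjTranspose, Matrix.mul_apply, Fin.sum_univ_two]
  have hstar : opNorm (star M) = opNorm M := by
    unfold opNorm
    rw [map_star]
    exact norm_star (E := R2 →L[ℝ] R2) _
  calc opNorm M⁻¹ ≤ opNorm (star J * star M) * opNorm J := by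
        rw [hinv]; exact opNorm_mul_le _ _
    _ ≤ opNorm (star J) * opNorm (star M) * opNorm J := by
        gcongr
        · exact norm_nonneg _
        · exact opNorm_mul_le _ _
    _ = opNorm M := by
        rw [hu J hJu, hu _ (Unitary.star_mem hJu), hstar]; ring

theorem one_le_opNorm {M : Matrix (Fin 2) (Fin 2) ℝ} (hM : M.det = 1) : 1 ≤ opNorm M := by
  have h1 : (1 : ℝ) ≤ opNorm M * opNorm M⁻¹ := by
    rw [← opNorm_one, ← Matrix.mul_nonsing_inv M (by simp [hM])]
    exact opNorm_mul_le _ _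
  have h0 : 0 ≤ opNorm M := norm_nonneg _
  nlinarith [opNorm_inv_le hM]

theorem det_coc {Θ : Type*} (γ : Θ → Θ) {A : Θ → Matrix (Fin 2) (Fin 2) ℝ}
    (hdet : ∀ θ, (A θ).det = 1) (n : ℕ) (θ : Θ) : (coc γ A n θ).det = 1 := by
  induction n generalizing θ with
  | zero => simp [coc]
  | succ n ih => simp [coc, ih, hdet]

theorem coc_add {Θ : Type*} (γ : Θ → Θ) (A : Θ → Matrix (Fin 2) (Fin 2) ℝ) (n k : ℕ) (θ : Θ) :
    coc γ A (n + k) θ = coc γ A n (γ^[k] θ) * coc γ A k θ := by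
  induction k generalizing θ with
  | zero => simp [coc]
  | succ k ih =>
    rw [← add_assoc, coc, ih, coc, Function.iterate_succ_apply, Matrix.mul_assoc]

theorem coc_succ' {Θ : Type*} (γ : Θ → Θ) (A : Θ → Matrix (Fin 2) (Fin 2) ℝ) (n : ℕ) (θ : Θ) :
    coc γ A (n + 1) θ = A (γ^[n] θ) * coc γ A n θ := by
  rw [add_comm, coc_add]
  simp [coc]

/-- The running maximum of the Birkhoff sums, `max_{0 ≤ k ≤ n} S_k φ`. -/
def birkhoffMax {X : Type*} (T : X → X) (φ : X → ℝ) : ℕ → X → ℝ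
  | 0, _ => 0
  | n + 1, x => max 0 (φ x + birkhoffMax T φ n (T x))

theorem birkhoffMax_nonneg {X : Type*} (T : X → X) (φ : X → ℝ) (n : ℕ) (x : X) :
    0 ≤ birkhoffMax T φ n x := by
  cases n <;> simp [birkhoffMax]

theorem birkhoffMax_le_succ {X : Type*} (T : X → X) (φ : X → ℝ) (n : ℕ) (x : X) :
    birkhoffMax T φ n x ≤ birkhoffMax T φ (n + 1) x := by
  induction n generalizing x with
  | zero => exact birkhoffMax_nonneg T φ 1 x
  | succ n ih => exact max_le_max le_rfl (by gcongr; exact ih (T x))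

theorem birkhoffSum_le_birkhoffMax {X : Type*} (T : X → X) (φ : X → ℝ) (n : ℕ) (x : X) :
    birkhoffSum T φ n x ≤ birkhoffMax T φ n x := by
  induction n generalizing x with
  | zero => simp [birkhoffMax]
  | succ n ih =>
    rw [birkhoffSum_succ']
    exact le_max_of_le_right (by gcongr; exact ih (T x))

theorem measurable_birkhoffMax {X : Type*} [MeasurableSpace X] {T : X → X} (hT : Measurable T) {φ : X → ℝ} (hφ : Measurable φ)
    (n : ℕ) : Measurable (birkhoffMax T φ n) := by
  induction n with
  | zero => exact measurable_const
  | succ n ih => exact measurable_const.max (hφ.add (ih.comp hT))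

theorem integrable_birkhoffMax {X : Type*} [MeasurableSpace X] {μ : Measure X} {T : X → X} (hT : MeasurePreserving T μ μ)
    {φ : X → ℝ} (hφ : Integrable φ μ) (n : ℕ) : Integrable (birkhoffMax T φ n) μ := by
  induction n with
  | zero => exact integrable_zero _ _ _
  | succ n ih =>
    exact (integrable_zero _ _ _).sup (hφ.add (hT.integrable_comp_of_integrable ih))

theorem bddAbove_birkhoffMax_comp_iff {X : Type*} (T : X → X) (φ : X → ℝ) (x : X) :
    BddAbove (range fun n => birkhoffMax T φ n (T x)) ↔
      BddAbove (range fun n => birkhoffMax T φ n x) := by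
  constructor
  · rintro ⟨K, hK⟩
    refine ⟨max 0 (φ x + K), ?_⟩
    rintro _ ⟨n, rfl⟩
    refine (birkhoffMax_le_succ T φ n x).trans (max_le_max le_rfl ?_)
    gcongr
    exact hK ⟨n, rfl⟩
  · rintro ⟨K, hK⟩
    refine ⟨K - φ x, ?_⟩
    rintro _ ⟨n, rfl⟩
    have h1 : birkhoffMax T φ (n + 1) x ≤ K := hK ⟨n + 1, rfl⟩
    have h2 : φ x + birkhoffMax T φ n (T x) ≤ birkhoffMax T φ (n + 1) x := le_max_right _ _
    show birkhoffMax T φ n (T x) ≤ K - φ x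
    linarith

/-- The one-sided form of Birkhoff's theorem: the Birkhoff sums of an observable with negative
mean are almost surely bounded above. -/
theorem Ergodic.ae_birkhoffSum_le {X : Type*} [MeasurableSpace X] {μ : Measure X} {T : X → X} (hT : Ergodic T μ) {φ : X → ℝ}
    (hφ : Measurable φ) (hφi : Integrable φ μ) (hneg : ∫ x, φ x ∂μ < 0) :
    ∀ᵐ x ∂μ, ∃ K, ∀ n, birkhoffSum T φ n x ≤ K := by
  have hmp := hT.toMeasurePreserving
  set E : Set X := {x | BddAbove (range fun n => birkhoffMax T φ n x)} with hE
  have hEm : MeasurableSet E :=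
    measurableSet_bddAbove_range fun n => measurable_birkhoffMax hmp.measurable hφ n
  have hEinv : T ⁻¹' E = E := by
    ext x
    exact bddAbove_birkhoffMax_comp_iff T φ x
  rcases hT.toPreErgodic.ae_mem_or_ae_notMem hEm hEinv with hin | hout
  · filter_upwards [hin] with x hx
    obtain ⟨K, hK⟩ := hx
    exact ⟨K, fun n => (birkhoffSum_le_birkhoffMax T φ n x).trans (hK ⟨n, rfl⟩)⟩
  · exfalso
    have hint := integrable_birkhoffMax hmp hφi
    set D : ℕ → X → ℝ := fun n x => birkhoffMax T φ (n + 1) x - birkhoffMax T φ n (T x) with hD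
    have hcomp : ∀ n, Integrable (fun x => birkhoffMax T φ n (T x)) μ := fun n =>
      hmp.integrable_comp_of_integrable (hint n)
    have hDint : ∀ n, 0 ≤ ∫ x, D n x ∂μ := by
      intro n
      have h1 : ∫ x, birkhoffMax T φ n (T x) ∂μ = ∫ x, birkhoffMax T φ n x ∂μ := by
        have h2 := integral_map (μ := μ) hmp.measurable.aemeasurable
          (f := birkhoffMax T φ n)
          (measurable_birkhoffMax hmp.measurable hφ n).aestronglyMeasurable
        rw [hmp.map_eq] at h2
        exact h2.symm
      rw [integral_sub (hint (n + 1)) (hcomp n), h1, sub_nonneg]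
      exact integral_mono (hint n) (hint (n + 1)) fun x => birkhoffMax_le_succ T φ n x
    have hDeq : ∀ n x, D n x = max (-birkhoffMax T φ n (T x)) (φ x) := by
      intro n x
      simp only [hD, birkhoffMax, ← max_sub_sub_right]
      congr 1 <;> ring
    have hlim : Tendsto (fun n => ∫ x, D n x ∂μ) atTop (𝓝 (∫ x, φ x ∂μ)) := by
      refine tendsto_integral_of_dominated_convergence (fun x => |φ x|)
        (fun n => ((hint (n + 1)).sub (hcomp n)).aestronglyMeasurable) hφi.abs ?_ ?_
      · intro n
        refine Eventually.of_forall fun x => ?_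
        have h0 := birkhoffMax_nonneg T φ n (T x)
        rw [hDeq, Real.norm_eq_abs, abs_le]
        refine ⟨le_max_of_le_right (neg_abs_le _), max_le ?_ (le_abs_self _)⟩
        linarith [abs_nonneg (φ x)]
      · filter_upwards [hout] with x hx
        have hx' : ¬ BddAbove (range fun n => birkhoffMax T φ n (T x)) := by
          rwa [bddAbove_birkhoffMax_comp_iff]
        rw [not_bddAbove_iff] at hx'
        obtain ⟨_, ⟨N, rfl⟩, hN⟩ := hx' (-φ x)
        refine tendsto_const_nhds.congr' ?_
        filter_upwards [eventually_ge_atTop N] with n hn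
        have h2 := monotone_nat_of_le_succ (fun k => birkhoffMax_le_succ T φ k (T x)) hn
        rw [hDeq, max_eq_right]
        linarith
    exact absurd (ge_of_tendsto' hlim hDint) (not_le.mpr hneg)

theorem GoodH.div_antitone {h : ℝ → ℝ} (hh : GoodH h) {x y : ℝ} (hx : 0 < x) (hxy : x ≤ y) :
    h y / y ≤ h x / x := by
  obtain ⟨-, -, hc, -, -, h0, -⟩ := hh
  have hy : 0 < y := hx.trans_le hxy
  have := hc.concaveOn.2 (show (0 : ℝ) ∈ Ici 0 by simp) (show y ∈ Ici 0 from hy.le)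
    (show 0 ≤ 1 - x / y by rw [sub_nonneg, div_le_one hy]; exact hxy)
    (show 0 ≤ x / y by positivity) (by ring)
  simp only [smul_eq_mul, mul_zero, zero_add, h0] at this
  rw [div_mul_cancel₀ _ hy.ne'] at this
  rw [div_le_div_iff₀ hy hx]
  rw [div_mul_eq_mul_div, div_le_iff₀ hy] at this
  linarith

theorem GoodH.div_lt_one {h : ℝ → ℝ} (hh : GoodH h) {x : ℝ} (hx : 0 < x) : h x / x < 1 := by
  have hle : ∀ y, 0 < y → h y / y ≤ 1 := by
    intro y hy
    obtain ⟨hC, -, -, -, -, h0, hd⟩ := id hh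
    have hda : HasDerivWithinAt h 1 (Ici 0) 0 := by
      rw [← hd]
      exact ((hC.differentiableOn (by norm_num)) 0 (by simp)).hasDerivWithinAt
    rw [hasDerivWithinAt_iff_tendsto_slope, Ici_sdiff_left] at hda
    refine ge_of_tendsto hda ?_
    filter_upwards [Ioc_mem_nhdsGT hy] with z hz
    rw [slope_def_field, h0, sub_zero, sub_zero]
    exact hh.div_antitone hz.1 hz.2
  obtain ⟨-, -, hc, -, -, h0, -⟩ := id hh
  have := hc.2 (show (0 : ℝ) ∈ Ici 0 by simp) (show x ∈ Ici 0 from hx.le) hx.ne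
    (show (0 : ℝ) < 1 / 2 by norm_num) (show (0 : ℝ) < 1 / 2 by norm_num) (by norm_num)
  simp only [smul_eq_mul, mul_zero, zero_add, h0] at this
  have h2 := hle (1 / 2 * x) (by positivity)
  rw [div_le_one (by positivity)] at h2
  rw [_root_.div_lt_one hx]
  linarith

theorem GoodH.div_nonneg {h : ℝ → ℝ} (hh : GoodH h) {x : ℝ} (hx : 0 < x) : 0 ≤ h x / x :=
  _root_.div_nonneg (hh.2.2.2.2.1 x hx.le) hx.le

theorem GoodH.div_pos {h : ℝ → ℝ} (hh : GoodH h) {x : ℝ} (hx : 0 < x) : 0 < h x / x := by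
  have h1 := hh.2.1 (show (0 : ℝ) ∈ Ici 0 by simp) (show x ∈ Ici 0 from hx.le) hx
  rw [hh.2.2.2.2.2.1] at h1
  exact _root_.div_pos h1 hx

section Cocycle

variable {Θ : Type*} {γ : Θ → Θ} {A : Θ → Matrix (Fin 2) (Fin 2) ℝ}

theorem continuous_opNorm : Continuous opNorm := by
  have h1 : Continuous
      ((Matrix.toEuclideanCLM (n := Fin 2) (𝕜 := ℝ)).toAlgEquiv.toLinearMap) :=
    LinearMap.continuous_of_finiteDimensional _
  exact h1.norm

theorem measurable_opNorm_coc [MeasurableSpace Θ] (hγ : Measurable γ)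
    (hA : ∀ i j, Measurable fun θ => A θ i j) (n : ℕ) :
    Measurable fun θ => opNorm (coc γ A n θ) := by
  have hentry : ∀ i j, Measurable fun θ => coc γ A n θ i j := by
    induction n with
    | zero => exact fun i j => measurable_const
    | succ n ih =>
      intro i j
      simp only [coc, Matrix.mul_apply]
      exact Finset.measurable_sum _ fun k _ => ((ih i k).comp hγ).mul (hA k j)
  have hcont : Continuous fun f : Fin 2 → Fin 2 → ℝ => opNorm (Matrix.of f) :=
    continuous_opNorm.comp continuous_id
  exact hcont.measurable.comp
    (measurable_pi_iff.mpr fun i => measurable_pi_iff.mpr fun j => hentry i j)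

theorem log_opNorm_coc_nonneg (hdet : ∀ θ, (A θ).det = 1) (n : ℕ) (θ : Θ) :
    0 ≤ Real.log (opNorm (coc γ A n θ)) :=
  Real.log_nonneg (one_le_opNorm (det_coc γ hdet n θ))

theorem log_opNorm_coc_add_le (hdet : ∀ θ, (A θ).det = 1) (n k : ℕ) (θ : Θ) :
    Real.log (opNorm (coc γ A (n + k) θ)) ≤
      Real.log (opNorm (coc γ A n (γ^[k] θ))) + Real.log (opNorm (coc γ A k θ)) := by
  have hpos : ∀ n θ, 0 < opNorm (coc γ A n θ) := fun n θ =>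
    zero_lt_one.trans_le (one_le_opNorm (det_coc γ hdet n θ))
  rw [← Real.log_mul (hpos _ _).ne' (hpos _ _).ne']
  apply Real.log_le_log (hpos _ _)
  rw [coc_add]
  exact opNorm_mul_le _ _

theorem log_opNorm_coc_le_add (hdet : ∀ θ, (A θ).det = 1) (n k : ℕ) (θ : Θ) :
    Real.log (opNorm (coc γ A k θ)) ≤
      Real.log (opNorm (coc γ A n (γ^[k] θ))) + Real.log (opNorm (coc γ A (n + k) θ)) := by
  have hpos : ∀ n θ, 0 < opNorm (coc γ A n θ) := fun n θ =>
    zero_lt_one.trans_le (one_le_opNorm (det_coc γ hdet n θ))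
  rw [← Real.log_mul (hpos _ _).ne' (hpos _ _).ne']
  apply Real.log_le_log (hpos _ _)
  have hd := det_coc γ hdet n (γ^[k] θ)
  have heq : coc γ A k θ = (coc γ A n (γ^[k] θ))⁻¹ * coc γ A (n + k) θ := by
    rw [coc_add, Matrix.nonsing_inv_mul_cancel_left _ _ (by simp [hd])]
  calc opNorm (coc γ A k θ)
      ≤ opNorm (coc γ A n (γ^[k] θ))⁻¹ * opNorm (coc γ A (n + k) θ) := by
        conv_lhs => rw [heq]
        exact opNorm_mul_le _ _
    _ ≤ _ := mul_le_mul_of_nonneg_right (opNorm_inv_le hd) (norm_nonneg _)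

theorem log_opNorm_coc_le (hdet : ∀ θ, (A θ).det = 1) {C : ℝ} (hC : ∀ θ, opNorm (A θ) ≤ C)
    (n : ℕ) (θ : Θ) : Real.log (opNorm (coc γ A n θ)) ≤ n * Real.log C := by
  induction n generalizing θ with
  | zero => simp [coc, opNorm_one]
  | succ n ih =>
    have h1 := log_opNorm_coc_add_le (γ := γ) hdet n 1 θ
    have h2 : Real.log (opNorm (coc γ A 1 θ)) ≤ Real.log C := by
      simp only [coc, one_mul]
      exact Real.log_le_log (zero_lt_one.trans_le (one_le_opNorm (hdet θ))) (hC θ)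
    push_cast
    linarith [ih (γ^[1] θ)]

theorem sum_log_opNorm_coc_le (hdet : ∀ θ, (A θ).det = 1) (N n : ℕ) (θ : Θ) :
    ∑ j ∈ Finset.range N, Real.log (opNorm (coc γ A (n + j) θ)) ≤
      ∑ j ∈ Finset.range N, Real.log (opNorm (coc γ A j θ)) +
        birkhoffSum γ (fun θ => Real.log (opNorm (coc γ A N θ))) n θ := by
  induction n with
  | zero => simp
  | succ n ih =>
    have h1 := Finset.sum_range_succ (fun j => Real.log (opNorm (coc γ A (n + j) θ))) N
    have h2 := Finset.sum_range_succ' (fun j => Real.log (opNorm (coc γ A (n + j) θ))) N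
    have h3 := log_opNorm_coc_add_le (γ := γ) hdet N n θ
    rw [add_comm N n] at h3
    rw [birkhoffSum_succ]
    have h4 : ∀ j, n + 1 + j = n + (j + 1) := fun j => by ring
    simp only [h4]
    rw [add_zero] at h2
    linarith

/-- The cocycle grows subexponentially along almost every orbit if its mean exponent vanishes. -/
theorem ae_log_opNorm_coc_le [MeasurableSpace Θ] {m : Measure Θ} [IsProbabilityMeasure m]
    (herg : Ergodic γ m) (hdet : ∀ θ, (A θ).det = 1)
    (hA : ∀ i j, Measurable fun θ => A θ i j) {C : ℝ} (hC : ∀ θ, opNorm (A θ) ≤ C)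
    (hlam : Tendsto (fun n : ℕ => (∫ θ, Real.log (opNorm (coc γ A n θ)) ∂m) / n) atTop (𝓝 0))
    {ε : ℝ} (hε : 0 < ε) :
    ∀ᵐ θ ∂m, ∃ K, ∀ n : ℕ, Real.log (opNorm (coc γ A n θ)) ≤ ε * n + K := by
  obtain ⟨N, hNε, hN⟩ := ((hlam.eventually (gt_mem_nhds hε)).and (eventually_ge_atTop 1)).exists
  have hN0 : (0 : ℝ) < N := by exact_mod_cast hN
  rw [div_lt_iff₀ hN0] at hNε
  set a : Θ → ℝ := fun θ => Real.log (opNorm (coc γ A N θ)) with ha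
  have ham : Measurable a :=
    Real.measurable_log.comp (measurable_opNorm_coc herg.measurable hA N)
  have hai : Integrable a m := by
    refine Integrable.of_bound ham.aestronglyMeasurable (N * Real.log C)
      (Eventually.of_forall fun θ => ?_)
    rw [Real.norm_of_nonneg (log_opNorm_coc_nonneg hdet N θ)]
    exact log_opNorm_coc_le hdet hC N θ
  have hneg : ∫ θ, (a θ - ε * N) ∂m < 0 := by
    rw [integral_sub hai (integrable_const _)]
    simpa using hNε
  filter_upwards [herg.ae_birkhoffSum_le (ham.sub measurable_const)
    (hai.sub (integrable_const _)) hneg] with θ hθ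
  obtain ⟨K, hK⟩ := hθ
  refine ⟨(∑ j ∈ Finset.range N, Real.log (opNorm (coc γ A j θ)) + K +
    ∑ j ∈ Finset.range N, j * Real.log C) / N, fun n => ?_⟩
  have h1 : birkhoffSum γ (fun θ => a θ - ε * N) n θ = birkhoffSum γ a n θ - n * (ε * N) := by
    simp [birkhoffSum, Finset.sum_sub_distrib]
  have h2 : birkhoffSum γ (fun θ => a θ - ε * N) n θ ≤ K := hK n
  rw [h1] at h2
  have h3 := sum_log_opNorm_coc_le (γ := γ) hdet N n θ
  have h4 : ∑ _j ∈ Finset.range N, Real.log (opNorm (coc γ A n θ)) ≤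
      ∑ j ∈ Finset.range N, (j * Real.log C + Real.log (opNorm (coc γ A (n + j) θ))) := by
    refine Finset.sum_le_sum fun j _ => ?_
    have := log_opNorm_coc_le_add (γ := γ) hdet j n θ
    rw [add_comm j n] at this
    linarith [log_opNorm_coc_le (γ := γ) hdet hC j (γ^[n] θ)]
  rw [Finset.sum_add_distrib, Finset.sum_const, Finset.card_range, nsmul_eq_mul] at h4
  rw [← sub_le_iff_le_add', le_div_iff₀ hN0]
  linarith

end Cocycle

section Dynamics

variable {Θ : Type*} {A : Θ → Matrix (Fin 2) (Fin 2) ℝ} {h : ℝ → ℝ}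

theorem exists_fibMap_eq_smul (hh : GoodH h) (θ : Θ) (v : R2) :
    ∃ r : ℝ, 0 ≤ r ∧ r ≤ 1 ∧ (∀ ε, 0 < ε → ε ≤ ‖v‖ → r ≤ h ε / ε) ∧
      fibMap A h 1 θ v = r • mulVecE (A θ) v := by
  by_cases hv : v = 0
  · refine ⟨1, zero_le_one, le_rfl, fun ε h1 h2 => ?_, ?_⟩
    · rw [hv, norm_zero] at h2
      exact absurd h1 h2.not_gt
    · have : mulVecE (A θ) 0 = 0 := by simpa using mulVecE_smul (A θ) 0 0
      simp [fibMap, hv, this]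
  · have hv' : 0 < ‖v‖ := norm_pos_iff.mpr hv
    refine ⟨h ‖v‖ / ‖v‖, hh.div_nonneg hv', (hh.div_lt_one hv').le,
      fun ε h1 h2 => hh.div_antitone h1 h2, ?_⟩
    simp [fibMap, hv]

/-- Up to a contraction factor, orbits of the skew product are orbits of the linear cocycle. Each
visit outside the ball of radius `ε` contributes at least `h ε / ε` to the contraction. -/
theorem exists_skewProd_iterate_eq_smul (hh : GoodH h) (γ : Θ → Θ) (n : ℕ) (θ : Θ) (v : R2) :
    ∃ c : ℝ, 0 ≤ c ∧ c ≤ 1 ∧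
      (∀ ε, 0 < ε → c ≤ (h ε / ε) ^
        ({i ∈ Finset.range n | ε ≤ ‖((skewProd γ A h 1)^[i] (θ, v)).2‖} : Finset ℕ).card) ∧
      (skewProd γ A h 1)^[n] (θ, v) = (γ^[n] θ, c • mulVecE (coc γ A n θ) v) := by
  induction n with
  | zero => exact ⟨1, zero_le_one, le_rfl, fun ε _ => by simp, by simp [coc, mulVecE_one]⟩
  | succ n ih =>
    obtain ⟨c, hc0, hc1, hcε, hc⟩ := ih
    obtain ⟨r, hr0, hr1, hrε, hr⟩ :=
      exists_fibMap_eq_smul (A := A) hh (γ^[n] θ) (c • mulVecE (coc γ A n θ) v)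
    refine ⟨r * c, mul_nonneg hr0 hc0, mul_le_one₀ hr1 hc0 hc1, fun ε hε => ?_, ?_⟩
    · rw [Finset.range_add_one, Finset.filter_insert]
      split_ifs with hcase
      · rw [Finset.card_insert_of_notMem (by simp), pow_succ']
        rw [hc] at hcase
        exact mul_le_mul (hrε ε hε hcase) (hcε ε hε) hc0 (hh.div_nonneg hε)
      · exact (mul_le_of_le_one_left hc0 hr1).trans (hcε ε hε)
    · rw [Function.iterate_succ_apply', hc, Function.iterate_succ_apply', coc_succ', mulVecE_mul]
      simp only [skewProd, hr, mulVecE_smul, smul_smul]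

theorem skewProd_iterate_neg (γ : Θ → Θ) (β : ℝ) (n : ℕ) (θ : Θ) (v : R2) :
    (skewProd γ A h β)^[n] (θ, -v) =
      (((skewProd γ A h β)^[n] (θ, v)).1, -((skewProd γ A h β)^[n] (θ, v)).2) := by
  induction n generalizing θ v with
  | zero => rfl
  | succ n ih =>
    have h1 : skewProd γ A h β (θ, -v) = (γ θ, -fibMap A h β θ v) := by
      by_cases hv : v = 0 <;> simp [skewProd, fibMap, hv, mulVecE_neg]
    rw [Function.iterate_succ_apply, h1, ih]
    rfl

theorem skewProd_iterate_fst (γ : Θ → Θ) (β : ℝ) (n : ℕ) (p : Θ × R2) :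
    ((skewProd γ A h β)^[n] p).1 = γ^[n] p.1 := by
  induction n generalizing p with
  | zero => rfl
  | succ n ih =>
    rw [Function.iterate_succ_apply, ih]
    rfl

theorem skewProd_iterate_zero (γ : Θ → Θ) (β : ℝ) (n : ℕ) (θ : Θ) :
    (skewProd γ A h β)^[n] (θ, 0) = (γ^[n] θ, 0) := by
  induction n generalizing θ with
  | zero => rfl
  | succ n ih =>
    rw [Function.iterate_succ_apply, Function.iterate_succ_apply, ← ih]
    simp [skewProd, fibMap]

theorem neg_mem_attractorFib {γ : Θ → Θ} {β : ℝ} {θ : Θ} {x : R2}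
    (hx : x ∈ attractorFib γ A h β θ) : -x ∈ attractorFib γ A h β θ := by
  simp only [attractorFib, globalAttractor, mem_ofPred_eq, mem_iInter] at hx ⊢
  intro n
  obtain ⟨⟨η, w⟩, ⟨-, hw⟩, hp⟩ := hx n
  refine ⟨(η, -w), ⟨mem_univ _, by simpa using hw⟩, ?_⟩
  rw [skewProd_iterate_neg, hp]

theorem zero_mem_attractorFib (γ : Θ ≃ Θ) (β : ℝ) (θ : Θ) :
    (0 : R2) ∈ attractorFib γ A h β θ := by
  simp only [attractorFib, globalAttractor, mem_ofPred_eq, mem_iInter]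
  intro n
  refine ⟨(γ.symm^[n] θ, 0), ⟨mem_univ _, by simp⟩, ?_⟩
  rw [skewProd_iterate_zero, (γ.rightInverse_symm.iterate n) θ]

theorem exists_iterate_eq_of_mem_attractorFib {γ : Θ ≃ Θ} {β : ℝ} {θ : Θ} {x : R2}
    (hx : x ∈ attractorFib γ A h β θ) (n : ℕ) :
    ∃ w : R2, ‖w‖ ≤ 1 ∧ (skewProd γ A h β)^[n] (γ.symm^[n] θ, w) = (θ, x) := by
  simp only [attractorFib, globalAttractor, mem_ofPred_eq, mem_iInter] at hx
  obtain ⟨⟨η, w⟩, ⟨-, hw⟩, hp⟩ := hx n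
  have h1 : γ^[n] η = θ := by
    rw [← skewProd_iterate_fst (A := A) (h := h) γ β n (η, w), hp]
  refine ⟨w, by simpa using hw, ?_⟩
  rw [← h1, (γ.leftInverse_symm.iterate n) η, hp, h1]

theorem attractorFib_eq_zero_of_bounded (hh : GoodH h) (hdet : ∀ θ, (A θ).det = 1)
    {γ : Θ ≃ Θ} {θ : Θ} {K : ℝ} (hK : ∀ n, opNorm (coc γ A n (γ.symm^[n] θ)) ≤ K)
    {x : R2} (hx : x ∈ attractorFib γ A h 1 θ) : x = 0 := by
  by_contra hx0
  have hxpos : 0 < ‖x‖ := norm_pos_iff.mpr hx0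
  have hK1 : 1 ≤ K := (one_le_opNorm (det_coc γ hdet 0 _)).trans (hK 0)
  have hK0 : 0 < K := zero_lt_one.trans_le hK1
  set ε := ‖x‖ / K with hε
  have hεpos : 0 < ε := div_pos hxpos hK0
  have key : ∀ n : ℕ, ‖x‖ ≤ (h ε / ε) ^ n * K := by
    intro n
    obtain ⟨w, hw, hwx⟩ := exists_iterate_eq_of_mem_attractorFib hx n
    have hbig : ∀ i ∈ Finset.range n,
        ε ≤ ‖((skewProd γ A h 1)^[i] (γ.symm^[n] θ, w)).2‖ := by
      intro i hi
      have hi' : i < n := Finset.mem_range.mp hi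
      set p := (skewProd γ A h 1)^[i] (γ.symm^[n] θ, w) with hp
      have hfst : p.1 = γ.symm^[n - i] θ := by
        have : n = i + (n - i) := by omega
        rw [hp, skewProd_iterate_fst]
        conv_lhs => rw [this, Function.iterate_add_apply]
        exact (γ.rightInverse_symm.iterate i) _
      have hpx : (skewProd γ A h 1)^[n - i] (p.1, p.2) = (θ, x) := by
        rw [← hwx, hp, Prod.mk.eta, ← Function.iterate_add_apply, Nat.sub_add_cancel hi'.le]
      obtain ⟨c, hc0, hc1, -, hc⟩ :=
        exists_skewProd_iterate_eq_smul (A := A) hh γ (n - i) p.1 p.2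
      have hxe : x = c • mulVecE (coc γ A (n - i) p.1) p.2 :=
        congrArg Prod.snd (hpx.symm.trans hc)
      rw [hε, div_le_iff₀ hK0, hxe, norm_smul, Real.norm_of_nonneg hc0]
      have h1 := norm_mulVecE_le (coc γ A (n - i) p.1) p.2
      have h2 := hK (n - i)
      rw [← hfst] at h2
      calc c * ‖mulVecE (coc γ A (n - i) p.1) p.2‖
          ≤ ‖mulVecE (coc γ A (n - i) p.1) p.2‖ := mul_le_of_le_one_left (norm_nonneg _) hc1
        _ ≤ K * ‖p.2‖ := h1.trans (mul_le_mul_of_nonneg_right h2 (norm_nonneg _))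
        _ = ‖p.2‖ * K := mul_comm _ _
    obtain ⟨c, hc0, -, hcε, hc⟩ :=
      exists_skewProd_iterate_eq_smul (A := A) hh γ n (γ.symm^[n] θ) w
    have hcn := hcε ε hεpos
    rw [Finset.filter_true_of_mem hbig, Finset.card_range] at hcn
    have hxe : x = c • mulVecE (coc γ A n (γ.symm^[n] θ)) w :=
      congrArg Prod.snd (hwx.symm.trans hc)
    rw [hxe, norm_smul, Real.norm_of_nonneg hc0]
    refine mul_le_mul hcn ?_ (norm_nonneg _) (pow_nonneg (hh.div_nonneg hεpos) n)
    calc ‖mulVecE (coc γ A n (γ.symm^[n] θ)) w‖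
        ≤ opNorm (coc γ A n (γ.symm^[n] θ)) * ‖w‖ := norm_mulVecE_le _ _
      _ ≤ K * 1 := mul_le_mul (hK n) hw (norm_nonneg _) hK0.le
      _ = K := mul_one K
  have hlim : Tendsto (fun n : ℕ => (h ε / ε) ^ n * K) atTop (𝓝 (0 * K)) :=
    (tendsto_pow_atTop_nhds_zero_of_lt_one (hh.div_nonneg hεpos)
      (hh.div_lt_one hεpos)).mul_const K
  rw [zero_mul] at hlim
  exact absurd (ge_of_tendsto' hlim key) (not_le.mpr hxpos)

/-- Every fibre of the attractor at `β = 1` misses an open ray. -/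
theorem exists_ray_disjoint_attractorFib (hh : GoodH h) (hdet : ∀ θ, (A θ).det = 1)
    (γ : Θ ≃ Θ) (θ : Θ) :
    ∃ u : R2, ‖u‖ = 1 ∧ ∀ s : ℝ, 0 < s → s • u ∉ attractorFib γ A h 1 θ := by
  by_cases hbdd : ∃ K, ∀ n, opNorm (coc γ A n (γ.symm^[n] θ)) ≤ K
  · obtain ⟨K, hK⟩ := hbdd
    refine ⟨EuclideanSpace.single 0 1, by simp, fun s hs hmem => ?_⟩
    have := attractorFib_eq_zero_of_bounded hh hdet hK hmem
    simp [hs.ne'] at this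
  · set M : ℕ → Matrix (Fin 2) (Fin 2) ℝ := fun n => coc γ A n (γ.symm^[n] θ) with hM
    have hMdet : ∀ n, (M n).det = 1 := fun n => det_coc γ hdet n _
    obtain ⟨u₀, hu₀⟩ : ∃ u₀ : R2, ¬ ∃ K, ∀ n, ‖mulVecE (M n)⁻¹ u₀‖ ≤ K := by
      by_contra! hcon
      obtain ⟨K, hK⟩ := banach_steinhaus
        (g := fun n => (Matrix.toEuclideanCLM (𝕜 := ℝ) (M n)⁻¹ : R2 →L[ℝ] R2)) hcon
      refine hbdd ⟨K, fun n => le_trans ?_ (hK n)⟩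
      have h1 : ((M n)⁻¹).det = 1 := by simp [Matrix.det_nonsing_inv, hMdet]
      have h2 := opNorm_inv_le h1
      rwa [Matrix.nonsing_inv_nonsing_inv _ (by simp [hMdet])] at h2
    have hne : u₀ ≠ 0 := by
      rintro rfl
      exact hu₀ ⟨0, fun n => by simpa using (norm_mulVecE_le (M n)⁻¹ 0)⟩
    have hpos : 0 < ‖u₀‖ := norm_pos_iff.mpr hne
    refine ⟨‖u₀‖⁻¹ • u₀, by simp [norm_smul, hpos.ne'], fun s hs hmem => hu₀ ?_⟩
    refine ⟨1 / (s * ‖u₀‖⁻¹), fun n => ?_⟩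
    obtain ⟨w, hw, hwx⟩ := exists_iterate_eq_of_mem_attractorFib hmem n
    obtain ⟨c, hc0, hc1, -, hc⟩ :=
      exists_skewProd_iterate_eq_smul (A := A) hh γ n (γ.symm^[n] θ) w
    have hxe : s • ‖u₀‖⁻¹ • u₀ = c • mulVecE (M n) w := congrArg Prod.snd (hwx.symm.trans hc)
    have h1 := congrArg (mulVecE (M n)⁻¹) hxe
    rw [smul_smul, mulVecE_smul, mulVecE_smul, ← mulVecE_mul,
      Matrix.nonsing_inv_mul _ (by simp [hMdet]), mulVecE_one] at h1
    have h2 := congrArg norm h1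
    have hs' : 0 < s * ‖u₀‖⁻¹ := by positivity
    rw [norm_smul, norm_smul, Real.norm_of_nonneg hc0, Real.norm_of_nonneg hs'.le] at h2
    rw [le_div_iff₀ hs', mul_comm, h2]
    exact mul_le_one₀ hc1 (norm_nonneg _) hw

theorem norm_fibMap_le_one (hdet : ∀ θ, (A θ).det = 1) {C : ℝ} (hC : ∀ θ, opNorm (A θ) ≤ C)
    (hscale : Scaled A h) (hh : GoodH h) (θ : Θ) (v : R2) : ‖fibMap A h 1 θ v‖ ≤ 1 := by
  by_cases hv : v = 0
  · simp [fibMap, hv]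
  have hv' : 0 < ‖v‖ := norm_pos_iff.mpr hv
  have hle : opNorm (A θ) ≤ ⨆ θ : Θ, opNorm (A θ) :=
    le_ciSup (f := fun θ => opNorm (A θ)) ⟨C, by rintro _ ⟨η, rfl⟩; exact hC η⟩ θ
  have hS : 0 < ⨆ θ : Θ, opNorm (A θ) :=
    zero_lt_one.trans_le ((one_le_opNorm (hdet θ)).trans hle)
  have hh0 : 0 ≤ h ‖v‖ := hh.2.2.2.2.1 _ hv'.le
  simp only [fibMap, hv, if_false, one_mul]
  rw [norm_smul, Real.norm_of_nonneg (hh.div_nonneg hv')]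
  calc h ‖v‖ / ‖v‖ * ‖mulVecE (A θ) v‖
      ≤ h ‖v‖ / ‖v‖ * (opNorm (A θ) * ‖v‖) :=
        mul_le_mul_of_nonneg_left (norm_mulVecE_le _ _) (hh.div_nonneg hv')
    _ = h ‖v‖ * opNorm (A θ) := by field_simp
    _ ≤ (⨆ θ : Θ, opNorm (A θ))⁻¹ * ⨆ θ : Θ, opNorm (A θ) :=
        mul_le_mul (hscale _ hv'.le) hle (norm_nonneg _) (by positivity)
    _ = 1 := inv_mul_cancel₀ hS.ne'

theorem norm_skewProd_iterate_le (hdet : ∀ θ, (A θ).det = 1) {C : ℝ}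
    (hC : ∀ θ, opNorm (A θ) ≤ C) (hscale : Scaled A h) (hh : GoodH h) (γ : Θ → Θ) (n : ℕ)
    (θ : Θ) (v : R2) : ‖((skewProd γ A h 1)^[n] (θ, v)).2‖ ≤ max 1 ‖v‖ := by
  cases n with
  | zero => exact le_max_right _ _
  | succ n =>
    rw [Function.iterate_succ_apply']
    exact (norm_fibMap_le_one hdet hC hscale hh _ _).trans (le_max_left _ _)

theorem exists_card_filter_le {γ : Θ → Θ} (hh : GoodH h) (hdet : ∀ θ, (A θ).det = 1) {θ : Θ}
    {δ K : ℝ} (hδ : 0 < δ) (hK : ∀ n : ℕ, Real.log (opNorm (coc γ A n θ)) ≤ δ * n + K) (v : R2)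
    {ε : ℝ} (hε : 0 < ε) :
    ∃ K' : ℝ, ∀ n : ℕ, -Real.log (h ε / ε) *
      (({i ∈ Finset.range n | ε ≤ ‖((skewProd γ A h 1)^[i] (θ, v)).2‖} : Finset ℕ).card : ℝ) ≤
        δ * n + K' := by
  refine ⟨max 0 (-Real.log (h ε / ε) + K + Real.log ‖v‖ - Real.log ε), fun n => ?_⟩
  induction n with
  | zero => simp
  | succ n ih =>
    rw [Finset.range_add_one, Finset.filter_insert]
    split_ifs with hcase
    · rw [Finset.card_insert_of_notMem (by simp)]
      obtain ⟨c, hc0, hc1, hcε, hc⟩ := exists_skewProd_iterate_eq_smul (A := A) hh γ n θ v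
      have hcn := hcε ε hε
      set k := ({i ∈ Finset.range n | ε ≤ ‖((skewProd γ A h 1)^[i] (θ, v)).2‖} : Finset ℕ).card
      have hop : 0 < opNorm (coc γ A n θ) :=
        zero_lt_one.trans_le (one_le_opNorm (det_coc γ hdet n θ))
      have hρ := hh.div_pos hε
      have h1 : ε ≤ (h ε / ε) ^ k * (opNorm (coc γ A n θ) * ‖v‖) := by
        refine hcase.trans ?_
        rw [hc, norm_smul, Real.norm_of_nonneg hc0]
        exact mul_le_mul hcn (norm_mulVecE_le _ _) (norm_nonneg _) (by positivity)
      have hv : 0 < ‖v‖ := by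
        by_contra hcon
        have : ‖v‖ = 0 := le_antisymm (not_lt.mp hcon) (norm_nonneg _)
        rw [this] at h1
        simp only [mul_zero] at h1
        exact absurd hε h1.not_gt
      have h2 := Real.log_le_log hε h1
      rw [Real.log_mul (by positivity) (by positivity), Real.log_mul hop.ne' hv.ne',
        Real.log_pow] at h2
      have h3 := hK n
      have h4 := le_max_right 0 (-Real.log (h ε / ε) + K + Real.log ‖v‖ - Real.log ε)
      push_cast
      linarith
    · push_cast
      linarith

theorem tendsto_div_atTop_zero_of_le {s : ℕ → ℝ} (hs : ∀ n, 0 ≤ s n)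
    (hle : ∀ ε, 0 < ε → ∃ K, ∀ n : ℕ, s n ≤ ε * n + K) :
    Tendsto (fun n : ℕ => s n / n) atTop (𝓝 0) := by
  rw [Metric.tendsto_atTop]
  intro ε hε
  obtain ⟨K, hK⟩ := hle (ε / 2) (half_pos hε)
  obtain ⟨N, hN⟩ := exists_nat_gt (K / (ε / 2))
  refine ⟨N + 1, fun n hn => ?_⟩
  have hn0 : (0 : ℝ) < n := by exact_mod_cast (Nat.succ_pos N).trans_le hn
  rw [Real.dist_eq, sub_zero, abs_of_nonneg (_root_.div_nonneg (hs n) hn0.le), div_lt_iff₀ hn0]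
  rw [div_lt_iff₀ (half_pos hε)] at hN
  have h1 : (N : ℝ) ≤ n := by exact_mod_cast (Nat.le_succ N).trans hn
  nlinarith [hK n]

theorem tendsto_average_norm_skewProd {γ : Θ → Θ} (hh : GoodH h) (hdet : ∀ θ, (A θ).det = 1)
    {C : ℝ} (hC : ∀ θ, opNorm (A θ) ≤ C) (hscale : Scaled A h) {θ : Θ}
    (hθ : ∀ δ, 0 < δ → ∃ K, ∀ n : ℕ, Real.log (opNorm (coc γ A n θ)) ≤ δ * n + K) (v : R2) :
    Tendsto (fun n : ℕ => (∑ i ∈ Finset.range n, ‖((skewProd γ A h 1)^[i] (θ, v)).2‖) / n)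
      atTop (𝓝 0) := by
  refine tendsto_div_atTop_zero_of_le (fun n => Finset.sum_nonneg fun i _ => norm_nonneg _) ?_
  intro ε hε
  set B := max 1 ‖v‖ with hB
  have hB0 : 0 < B := zero_lt_one.trans_le (le_max_left _ _)
  have hε2 := half_pos hε
  set q := -Real.log (h (ε / 2) / (ε / 2)) with hq
  have hq0 : 0 < q := neg_pos.mpr (Real.log_neg (hh.div_pos hε2) (hh.div_lt_one hε2))
  have hδ : 0 < q / B * (ε / 2) := by positivity
  obtain ⟨K, hK⟩ := hθ _ hδ
  obtain ⟨K', hK'⟩ := exists_card_filter_le hh hdet hδ hK v hε2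
  refine ⟨K' * B / q, fun n => ?_⟩
  set F : Finset ℕ := {i ∈ Finset.range n | ε / 2 ≤ ‖((skewProd γ A h 1)^[i] (θ, v)).2‖} with hF
  have h1 : ∑ i ∈ Finset.range n, ‖((skewProd γ A h 1)^[i] (θ, v)).2‖ ≤
      ∑ i ∈ Finset.range n,
        (ε / 2 + if ε / 2 ≤ ‖((skewProd γ A h 1)^[i] (θ, v)).2‖ then B else 0) := by
    refine Finset.sum_le_sum fun i _ => ?_
    split_ifs with hi
    · linarith [norm_skewProd_iterate_le hdet hC hscale hh γ i θ v]
    · linarith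
  rw [Finset.sum_add_distrib, ← Finset.sum_filter, Finset.sum_const, Finset.sum_const,
    Finset.card_range, nsmul_eq_mul, nsmul_eq_mul] at h1
  have h2 : (F.card : ℝ) * B ≤ ε / 2 * n + K' * B / q := by
    have h3 := hK' n
    rw [← hq, ← hF, mul_comm, ← le_div_iff₀ hq0] at h3
    calc (F.card : ℝ) * B ≤ (q / B * (ε / 2) * n + K') / q * B :=
          mul_le_mul_of_nonneg_right h3 hB0.le
      _ = ε / 2 * n + K' * B / q := by field_simp
  linarith

end Dynamics

theorem isPreconnected_closedBall_diff_singleton (p : R2) :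
    IsPreconnected (closedBall (0 : R2) 1 \ {p}) := by
  have hrank : 1 < Module.rank ℝ R2 := by
    rw [← Module.finrank_eq_rank, finrank_euclideanSpace_fin]
    norm_num
  have hball : IsPreconnected (ball (0 : R2) 1 \ {p}) := by
    by_cases hp : p ∈ ball (0 : R2) 1
    · have h1 := (isConnected_compl_singleton_of_one_lt_rank hrank
        (Homeomorph.unitBall.symm ⟨p, hp⟩ : R2)).isPreconnected.image
        (fun x => (Homeomorph.unitBall x : R2)) (by fun_prop)
      convert h1 using 1
      ext y
      constructor
      · rintro ⟨hy, hyp⟩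
        refine ⟨Homeomorph.unitBall.symm ⟨y, hy⟩, ?_, by simp⟩
        simpa using hyp
      · rintro ⟨x, hx, rfl⟩
        refine ⟨(Homeomorph.unitBall x).2, fun hxp => hx ?_⟩
        rw [mem_singleton_iff, Homeomorph.eq_symm_apply]
        exact Subtype.ext hxp
    · rw [sdiff_singleton_eq_self hp]
      exact isPreconnected_ball
  refine hball.subset_closure (sdiff_subset_sdiff_left ball_subset_closedBall) ?_
  rw [← closure_ball (0 : R2) one_ne_zero, sdiff_eq, sdiff_eq, inter_comm, inter_comm (ball _ _)]
  exact isOpen_compl_singleton.inter_closure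

/-- A symmetric planar set which misses a line through the origin (except the origin itself) is
not homeomorphic to a disk. -/
theorem not_nonempty_homeomorph_closedBall {S : Set R2} (h0 : (0 : R2) ∈ S)
    (hneg : ∀ x ∈ S, -x ∈ S) {u : R2} (hu : ‖u‖ = 1) (hray : ∀ s : ℝ, 0 < s → s • u ∉ S) :
    ¬ Nonempty (S ≃ₜ (closedBall (0 : R2) 1 : Set R2)) := by
  rintro ⟨φ⟩
  have hu2 : u 0 ^ 2 + u 1 ^ 2 = 1 := by
    have := EuclideanSpace.real_norm_sq_eq u
    rw [hu, Fin.sum_univ_two] at this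
    linarith
  set ℓ : R2 → ℝ := fun x => u 0 * x 1 - u 1 * x 0 with hℓ
  have hℓc : Continuous ℓ := by fun_prop
  have hℓ0 : ∀ x ∈ S, x ≠ 0 → ℓ x ≠ 0 := by
    intro x hx hx0 hlx
    have hxe : x = (u 0 * x 0 + u 1 * x 1) • u := by
      ext i
      simp only [hℓ] at hlx
      fin_cases i
      · simp
        linear_combination -x 0 * hu2 - u 1 * hlx
      · simp
        linear_combination -x 1 * hu2 + u 0 * hlx
    rcases lt_trichotomy (u 0 * x 0 + u 1 * x 1) 0 with hlt | heq | hgt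
    · refine hray _ (neg_pos.mpr hlt) ?_
      rw [neg_smul, ← hxe]
      exact hneg x hx
    · rw [heq, zero_smul] at hxe
      exact hx0 hxe
    · refine hray _ hgt ?_
      rwa [← hxe]
  set p : R2 := (φ ⟨0, h0⟩ : R2) with hp
  have hpre : IsPreconnected (S \ {0}) := by
    have h1 : IsPreconnected ({φ ⟨0, h0⟩}ᶜ : Set (closedBall (0 : R2) 1)) := by
      rw [← Topology.IsInducing.subtypeVal.isPreconnected_image]
      convert isPreconnected_closedBall_diff_singleton p using 1
      ext y
      simp [hp]
    convert h1.image (fun y => (φ.symm y : R2)) (by fun_prop) using 1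
    ext x
    constructor
    · rintro ⟨hx, hx0⟩
      refine ⟨φ ⟨x, hx⟩, fun hxe => hx0 ?_, by simp⟩
      exact congrArg Subtype.val (φ.injective hxe)
    · rintro ⟨y, hy, rfl⟩
      refine ⟨(φ.symm y).2, fun hy0 => hy ?_⟩
      rw [mem_singleton_iff, ← Homeomorph.symm_apply_eq]
      exact Subtype.ext hy0
  have hsub : ∀ x ∈ S, x = 0 := by
    intro x hx
    by_contra hx0
    have hord := (hpre.image ℓ hℓc.continuousOn).ordConnected
    have hxm : ℓ x ∈ ℓ '' (S \ {0}) := ⟨x, ⟨hx, hx0⟩, rfl⟩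
    have hnm : -ℓ x ∈ ℓ '' (S \ {0}) :=
      ⟨-x, ⟨hneg x hx, by simpa using hx0⟩, by simp only [hℓ, PiLp.neg_apply]; ring⟩
    have hzero : (0 : ℝ) ∈ ℓ '' (S \ {0}) := by
      rcases le_total (ℓ x) 0 with hle | hle
      · exact hord.out hxm hnm ⟨hle, by linarith⟩
      · exact hord.out hnm hxm ⟨by linarith, hle⟩
    obtain ⟨y, ⟨hy, hy0⟩, hy1⟩ := hzero
    exact hℓ0 y hy hy0 hy1
  have hu_mem : u ∈ closedBall (0 : R2) 1 := by simp [hu]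
  have h0_mem : (0 : R2) ∈ closedBall (0 : R2) 1 := by simp
  have heq : φ.symm ⟨u, hu_mem⟩ = φ.symm ⟨0, h0_mem⟩ :=
    Subtype.ext ((hsub _ (φ.symm _).2).trans (hsub _ (φ.symm _).2).symm)
  have hu0 : u = 0 := congrArg Subtype.val (φ.symm.injective heq)
  simp [hu0] at hu


/-- If `β = β₁^m = β₂^m` (i.e. `λ_m(A) = 0` and `β = 1`), then for m-a.e.
θ the attractor fibre is not a topological disk — there is a unit direction missed by
the fibre — and Birkhoff averages of the norms of forward orbits tend to 0. -/
theorem stmt7 {Θ : Type*} [MeasurableSpace Θ]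
    (γ : Θ ≃ Θ) (hγ : Measurable ⇑γ) (hγ' : Measurable ⇑γ.symm)
    (m : Measure Θ) [IsProbabilityMeasure m] (herg : Ergodic ⇑γ m)
    (A : Θ → Matrix (Fin 2) (Fin 2) ℝ) (hdet : ∀ θ, (A θ).det = 1)
    (hAmeas : ∀ i j, Measurable fun θ => A θ i j)
    (hAbdd : ∃ C : ℝ, ∀ θ, opNorm (A θ) ≤ C)
    (h : ℝ → ℝ) (hh : GoodH h) (hscale : Scaled A h)
    (lam : ℝ)
    (hlam : Filter.Tendsto
      (fun n : ℕ => (∫ θ, Real.log (opNorm (coc ⇑γ A n θ)) ∂m) / n)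
      Filter.atTop (𝓝 lam))
    (β : ℝ) (hβ1 : β = Real.exp (-lam)) (hβ2 : β = Real.exp lam) :
    ∀ᵐ θ ∂m,
      (¬ Nonempty
        ((attractorFib ⇑γ A h β θ) ≃ₜ (Metric.closedBall (0 : R2) 1 : Set R2))) ∧
      (∃ u : R2, ‖u‖ = 1 ∧ ∀ s : ℝ, 0 < s → s • u ∉ attractorFib ⇑γ A h β θ) ∧
      ∀ v : R2,
        Filter.Tendsto
          (fun n : ℕ => (∑ i ∈ Finset.range n, ‖((skewProd ⇑γ A h β)^[i] (θ, v)).2‖) / n)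
          Filter.atTop (𝓝 0) := by
  have hlam0 : lam = 0 := by
    have := Real.exp_injective (hβ1.symm.trans hβ2)
    linarith
  subst hlam0
  rw [Real.exp_zero] at hβ2
  subst hβ2
  obtain ⟨C, hC⟩ := hAbdd
  have hsub : ∀ᵐ θ ∂m, ∀ k : ℕ, ∃ K, ∀ n : ℕ,
      Real.log (opNorm (coc γ A n θ)) ≤ 1 / ((k : ℝ) + 1) * n + K :=
    ae_all_iff.mpr fun k =>
      ae_log_opNorm_coc_le herg hdet hAmeas hC hlam Nat.one_div_pos_of_nat
  filter_upwards [hsub] with θ hθ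
  obtain ⟨u, hu, hray⟩ := exists_ray_disjoint_attractorFib hh hdet γ θ
  refine ⟨not_nonempty_homeomorph_closedBall (zero_mem_attractorFib γ 1 θ)
    (fun x hx => neg_mem_attractorFib hx) hu hray, ⟨u, hu, hray⟩, fun v => ?_⟩
  refine tendsto_average_norm_skewProd hh hdet hC hscale (fun δ hδ => ?_) v
  obtain ⟨k, hk⟩ := exists_nat_one_div_lt hδ
  obtain ⟨K, hK⟩ := hθ k
  exact ⟨K, fun n => (hK n).trans (by gcongr)⟩
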